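/- arXiv:1602.06339 — 2 statements merged into one kernel-verified Lean document; each statement's English description precedes it below -/
import Mathlib

section
/- Let F be a field, K ∈ F_m, L ∈ F_n, and λ, ν ∈ Fˣ (nonzero elements of F). Let θ be the principal congruence on F_m × F_n generated by the pair ((K, L), (λ • K, ν • L)). Then for all (M, N), (M', N') ∈ F_m × F_n: (M, N) θ (M', N') if and only if (M, N) = (M', N'), or [rank M ≤ rank K, rank N ≤ rank L, and there exists z : ℤ such that M' = (λ^z : Fˣ) • M and N' = (ν^z : Fˣ) • N] (i.e., (M', N') is obtained from (M, N) by scaling with an element of the cyclic subgroup of Fˣ × Fˣ generated by (λ, ν)). -/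
lemma aux_factor_lin {F V : Type*} [Field F] [AddCommGroup V] [Module F V] [FiniteDimensional F V]
    (f g : V →ₗ[F] V)
    (h : Module.finrank F (LinearMap.range g) ≤ Module.finrank F (LinearMap.range f)) :
    ∃ a b : V →ₗ[F] V, g = a ∘ₗ f ∘ₗ b := by
  obtain ⟨i, hi⟩ := finrank_le_iff_exists_linearMap.1 h
  obtain ⟨j, hj⟩ := i.exists_leftInverse_of_injective (LinearMap.ker_eq_bot.2 hi)
  obtain ⟨a, ha⟩ := LinearMap.exists_extend ((LinearMap.range g).subtype ∘ₗ j)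
  obtain ⟨s, hs⟩ := f.rangeRestrict.exists_rightInverse_of_surjective f.range_rangeRestrict
  refine ⟨a, s ∘ₗ i ∘ₗ g.rangeRestrict, ?_⟩
  ext v
  have h1 := congrArg Subtype.val (LinearMap.congr_fun hs (i (g.rangeRestrict v)))
  have h2 := LinearMap.congr_fun ha (i (g.rangeRestrict v))
  have h3 := congrArg Subtype.val (LinearMap.congr_fun hj (g.rangeRestrict v))
  simp only [LinearMap.comp_apply, LinearMap.id_apply, Submodule.subtype_apply,
    LinearMap.codRestrict_apply, LinearMap.rangeRestrict] at h1 h2 h3 ⊢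
  rw [h1, h2, h3]

lemma aux_factor {F : Type*} [Field F] {m : ℕ} (K M : Matrix (Fin m) (Fin m) F)
    (h : M.rank ≤ K.rank) : ∃ A B, M = A * K * B := by
  obtain ⟨a, b, hab⟩ := aux_factor_lin K.mulVecLin M.mulVecLin h
  refine ⟨LinearMap.toMatrix' a, LinearMap.toMatrix' b, ?_⟩
  apply Matrix.toLin'.injective
  rw [Matrix.toLin'_mul, Matrix.toLin'_mul, Matrix.toLin'_toMatrix', Matrix.toLin'_toMatrix']
  exact hab

lemma aux_rank_smul {F : Type*} [Field F] {m : ℕ} (M : Matrix (Fin m) (Fin m) F) (u : Fˣ) :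
    ((u : F) • M).rank = M.rank :=
  Matrix.rank_smul_of_mem_nonZeroDivisors M (mem_nonZeroDivisors_of_ne_zero u.ne_zero)

/-- The explicit description, as a congruence. -/
def auxCon {F : Type*} [Field F] {m n : ℕ}
    (K : Matrix (Fin m) (Fin m) F) (L : Matrix (Fin n) (Fin n) F) (lam nu : Fˣ) :
    Con (Matrix (Fin m) (Fin m) F × Matrix (Fin n) (Fin n) F) where
  r p q := p = q ∨ (p.1.rank ≤ K.rank ∧ p.2.rank ≤ L.rank ∧
    ∃ z : ℤ, q.1 = ((lam ^ z : Fˣ) : F) • p.1 ∧ q.2 = ((nu ^ z : Fˣ) : F) • p.2)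
  iseqv := by
    refine ⟨fun _ => Or.inl rfl, ?_, ?_⟩
    · rintro ⟨a, b⟩ ⟨c, d⟩ (h | ⟨h1, h2, z, h3, h4⟩)
      · exact Or.inl h.symm
      · dsimp only at *
        subst h3 h4
        refine Or.inr ⟨by rwa [aux_rank_smul], by rwa [aux_rank_smul], -z, ?_, ?_⟩ <;>
        simp only [smul_smul, ← Units.val_mul, ← zpow_add] <;> simp
    · rintro ⟨a, b⟩ ⟨c, d⟩ ⟨e, f⟩ (h | ⟨h1, h2, z, h3, h4⟩) h'
      · rwa [h]
      · rcases h' with h' | ⟨h1', h2', w, h3', h4'⟩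
        · rw [← h']
          exact Or.inr ⟨h1, h2, z, h3, h4⟩
        · dsimp only at *
          subst h3 h4 h3' h4'
          refine Or.inr ⟨h1, h2, w + z, ?_, ?_⟩ <;>
          simp only [smul_smul, ← Units.val_mul, ← zpow_add]
  mul' := by
    rintro ⟨a, b⟩ ⟨c, d⟩ ⟨e, f⟩ ⟨g, h⟩ (h0 | ⟨h1, h2, z, h3, h4⟩) (h0' | ⟨h1', h2', w, h3', h4'⟩)
    · rw [h0, h0']
      exact Or.inl rfl
    · rw [h0]
      dsimp only at *
      subst h3' h4'
      exact Or.inr ⟨(Matrix.rank_mul_le_right _ _).trans h1', (Matrix.rank_mul_le_right _ _).trans h2',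
        w, by simp, by simp⟩
    · rw [h0']
      dsimp only at *
      subst h3 h4
      exact Or.inr ⟨(Matrix.rank_mul_le_left _ _).trans h1, (Matrix.rank_mul_le_left _ _).trans h2,
        z, by simp, by simp⟩
    · dsimp only at *
      subst h3 h4 h3' h4'
      refine Or.inr ⟨(Matrix.rank_mul_le_left _ _).trans h1, (Matrix.rank_mul_le_left _ _).trans h2,
        w + z, ?_, ?_⟩ <;>
      simp only [Prod.mk_mul_mk, Matrix.smul_mul, Matrix.mul_smul, smul_smul, zpow_add,
        Units.val_mul, mul_comm]

/-- description of the principal congruence on `F_m × F_n` generated by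
`((K, L), (λ • K, ν • L))` for units `λ, ν` of `F`. -/
theorem stmt_18 {F : Type*} [Field F] {m n : ℕ}
    (K : Matrix (Fin m) (Fin m) F) (L : Matrix (Fin n) (Fin n) F) (lam nu : Fˣ) :
    ∀ (M M' : Matrix (Fin m) (Fin m) F) (N N' : Matrix (Fin n) (Fin n) F),
      conGen (fun p q : Matrix (Fin m) (Fin m) F × Matrix (Fin n) (Fin n) F =>
          p = (K, L) ∧ q = ((lam : F) • K, (nu : F) • L)) (M, N) (M', N') ↔
        ((M, N) = (M', N') ∨
          (M.rank ≤ K.rank ∧ N.rank ≤ L.rank ∧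
            ∃ z : ℤ, M' = ((lam ^ z : Fˣ) : F) • M ∧ N' = ((nu ^ z : Fˣ) : F) • N)) := by
  intro M M' N N'
  set c := conGen (fun p q : Matrix (Fin m) (Fin m) F × Matrix (Fin n) (Fin n) F =>
          p = (K, L) ∧ q = ((lam : F) • K, (nu : F) • L)) with hc
  constructor
  · intro h
    have hle : c ≤ auxCon K L lam nu := by
      rw [hc, Con.conGen_le]
      rintro p q ⟨rfl, rfl⟩
      exact Or.inr ⟨le_rfl, le_rfl, 1, by simp, by simp⟩
    exact hle h
  · rintro (h | ⟨h1, h2, z, rfl, rfl⟩)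
    · rw [h]
      exact c.refl _
    · have step : ∀ (M : Matrix (Fin m) (Fin m) F) (N : Matrix (Fin n) (Fin n) F),
          M.rank ≤ K.rank → N.rank ≤ L.rank → c (M, N) ((lam : F) • M, (nu : F) • N) := by
        intro M N h1 h2
        obtain ⟨A, B, rfl⟩ := aux_factor K M h1
        obtain ⟨C, D, rfl⟩ := aux_factor L N h2
        have h0 : c (K, L) ((lam : F) • K, (nu : F) • L) := ConGen.Rel.of _ _ ⟨rfl, rfl⟩
        have := c.mul (c.mul (c.refl (A, C)) h0) (c.refl (B, D))
        simpa using this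
      induction z using Int.induction_on with
      | zero => simpa using c.refl (M, N)
      | succ k ih =>
        have := step (((lam ^ (k : ℤ) : Fˣ) : F) • M) (((nu ^ (k : ℤ) : Fˣ) : F) • N)
          (by rwa [aux_rank_smul]) (by rwa [aux_rank_smul])
        refine c.trans ih ?_
        rw [smul_smul, smul_smul, ← Units.val_mul, ← Units.val_mul, ← zpow_one_add,
          ← zpow_one_add, add_comm] at this
        exact this
      | pred k ih =>
        have := step (((lam ^ (-(k : ℤ) - 1) : Fˣ) : F) • M) (((nu ^ (-(k : ℤ) - 1) : Fˣ) : F) • N)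
          (by rwa [aux_rank_smul]) (by rwa [aux_rank_smul])
        refine c.trans ih (c.symm ?_)
        rw [smul_smul, smul_smul, ← Units.val_mul, ← Units.val_mul, ← zpow_one_add,
          ← zpow_one_add, add_sub_cancel] at this
        exact this
end

section
/- Let F be a field, K, K' ∈ F_m not H-related, L ∈ F_n, and λ ∈ Fˣ, and set L' = λ • L. Set j = max(rank K, rank K') and k = rank L. Let θ be the principal congruence on F_m × F_n generated by ((K, L), (K', L')). Then for all (M, N), (M', N') ∈ F_m × F_n: (M, N) θ (M', N') if and only if (M, N) = (M', N'), or [rank M ≤ j, rank M' ≤ j, rank N ≤ k, and there exists z : ℤ such that N' = (λ^z : Fˣ) • N]. -/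
/-- `A` and `B` are H-related in `F_r`: same column space and same kernel. -/
def HRelM {F : Type*} [Field F] {r : ℕ} (A B : Matrix (Fin r) (Fin r) F) : Prop :=
  LinearMap.range A.mulVecLin = LinearMap.range B.mulVecLin ∧
    LinearMap.ker A.mulVecLin = LinearMap.ker B.mulVecLin

open Module in
theorem aux_trans {F V : Type*} [Field F] [AddCommGroup V] [Module F V] (x y : V)
    (hx : x ≠ 0) (hy : y ≠ 0) : ∃ e : V ≃ₗ[F] V, e x = y := by
  let f := (LinearEquiv.toSpanNonzeroSingleton F V x hx).symm ≪≫ₗ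
    LinearEquiv.toSpanNonzeroSingleton F V y hy
  obtain ⟨g, hg⟩ := Submodule.exists_linearEquiv_restrict_eq f
  refine ⟨g, ?_⟩
  have h1 : (⟨x, Submodule.mem_span_singleton_self x⟩ : F ∙ x)
      = LinearEquiv.toSpanNonzeroSingleton F V x hx 1 := by
    apply Subtype.ext; simp
  have h := hg ⟨x, Submodule.mem_span_singleton_self x⟩
  have h2 : f ⟨x, Submodule.mem_span_singleton_self x⟩ =
      LinearEquiv.toSpanNonzeroSingleton F V y hy 1 := by
    rw [h1]; simp [f, -LinearEquiv.toSpanNonzeroSingleton_apply]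
  rw [h2] at h
  simpa using h.symm

open Module in
theorem aux_core {F V : Type*} [Field F] [AddCommGroup V] [Module F V] [FiniteDimensional F V]
    (K K' A : V →ₗ[F] V) (v : V) (hv' : K' v = 0) (hv : K v ≠ 0) (hA : A ≠ 0)
    (hr : finrank F (LinearMap.range A) ≤ finrank F (LinearMap.range K)) :
    ∃ P X : V →ₗ[F] V, P ∘ₗ K ∘ₗ X = A ∧
      finrank F (LinearMap.range (P ∘ₗ K' ∘ₗ X)) < finrank F (LinearMap.range A) := by
  have hdis : Disjoint (F ∙ v) (LinearMap.ker K) := by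
    rw [Submodule.disjoint_def]
    intro x hx hx'
    obtain ⟨c, rfl⟩ := Submodule.mem_span_singleton.1 hx
    have : c = 0 := by simpa [hv] using hx'
    simp [this]
  obtain ⟨C, hvC, hC⟩ := hdis.exists_isCompl
  have hvC' : v ∈ C := hvC (Submodule.mem_span_singleton_self v)
  have hfC : finrank F C = finrank F (LinearMap.range K) := by
    have h1 := Submodule.finrank_add_eq_of_isCompl hC
    have h2 := K.finrank_range_add_finrank_ker
    omega
  rw [← hfC] at hr
  obtain ⟨g, hg⟩ := finrank_le_iff_exists_linearMap.1 hr
  obtain ⟨u, hu⟩ : ∃ u, A u ≠ 0 := by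
    by_contra! h
    exact hA (LinearMap.ext h)
  let a : LinearMap.range A := ⟨A u, LinearMap.mem_range_self A u⟩
  have ha : a ≠ 0 := fun h => hu (congrArg Subtype.val h)
  have hv0 : (⟨v, hvC'⟩ : C) ≠ 0 := fun h => hv (by
    have : v = 0 := congrArg Subtype.val h
    simp [this])
  obtain ⟨e, he⟩ := aux_trans (F := F) (g a) ⟨v, hvC'⟩
    (fun h => ha (hg (by simpa using h))) hv0
  let h : LinearMap.range A →ₗ[F] V := C.subtype ∘ₗ e.toLinearMap ∘ₗ g
  have hKh : LinearMap.ker (K ∘ₗ h) = ⊥ := by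
    rw [LinearMap.ker_eq_bot']
    intro x hx
    have h1 : h x = 0 := Submodule.disjoint_def.1 hC.disjoint _ (e (g x)).2 (by simpa using hx)
    have h2 : e (g x) = 0 := Subtype.ext h1
    exact hg (by simpa using h2)
  obtain ⟨p, hp⟩ := LinearMap.exists_leftInverse_of_injective _ hKh
  refine ⟨(LinearMap.range A).subtype ∘ₗ p, h ∘ₗ A.rangeRestrict, ?_, ?_⟩
  · ext x
    have := LinearMap.congr_fun hp (A.rangeRestrict x)
    simpa using congrArg Subtype.val this
  · set Q := (LinearMap.range A).subtype ∘ₗ p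
    have hle : LinearMap.range (Q ∘ₗ K' ∘ₗ h ∘ₗ A.rangeRestrict) ≤
        LinearMap.range (Q ∘ₗ K' ∘ₗ h) := by
      rintro _ ⟨x, rfl⟩
      exact ⟨A.rangeRestrict x, rfl⟩
    refine (Submodule.finrank_mono hle).trans_lt ?_
    have h2 := (Q ∘ₗ K' ∘ₗ h).finrank_range_add_finrank_ker
    have h3 : 0 < finrank F (LinearMap.ker (Q ∘ₗ K' ∘ₗ h)) := by
      rw [Module.finrank_pos_iff_exists_ne_zero]
      have hha : h a = v := by simp [h, he]
      exact ⟨⟨a, by simp [hha, hv']⟩, fun h => ha (congrArg Subtype.val h)⟩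
    omega

theorem aux_mat {F : Type*} [Field F] {m : ℕ} (K K' A : Matrix (Fin m) (Fin m) F)
    (v : Fin m → F) (hv' : K'.mulVec v = 0) (hv : K.mulVec v ≠ 0) (hA : A ≠ 0)
    (hr : A.rank ≤ K.rank) :
    ∃ P X : Matrix (Fin m) (Fin m) F, P * K * X = A ∧ (P * K' * X).rank < A.rank := by
  obtain ⟨P, X, h1, h2⟩ := aux_core (Matrix.toLin' K) (Matrix.toLin' K') (Matrix.toLin' A) v
    (by simpa using hv') (by simpa using hv) (by simpa using hA) hr
  have key : ∀ B : Matrix (Fin m) (Fin m) F,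
      Matrix.toLin' (LinearMap.toMatrix' P * B * LinearMap.toMatrix' X)
        = P ∘ₗ Matrix.toLin' B ∘ₗ X := by
    intro B
    simp [Matrix.toLin'_mul, LinearMap.comp_assoc]
  refine ⟨LinearMap.toMatrix' P, LinearMap.toMatrix' X, ?_, ?_⟩
  · apply Matrix.toLin'.injective
    rw [key, h1]
  · rw [← key] at h2
    exact h2

theorem aux_mat2 {F : Type*} [Field F] {m : ℕ} (K K' A : Matrix (Fin m) (Fin m) F)
    (hKK : ¬ HRelM K K') (hrk : K'.rank ≤ K.rank) (hA : A ≠ 0)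
    (hr : A.rank ≤ K.rank) :
    ∃ P X : Matrix (Fin m) (Fin m) F, P * K * X = A ∧ (P * K' * X).rank < A.rank := by
  by_cases hker : LinearMap.ker K.mulVecLin = LinearMap.ker K'.mulVecLin
  · have hran : LinearMap.range K.mulVecLin ≠ LinearMap.range K'.mulVecLin :=
      fun h => hKK ⟨h, hker⟩
    have : ¬ LinearMap.range K.mulVecLin ≤ LinearMap.range K'.mulVecLin :=
      fun h => hran (Submodule.eq_of_le_of_finrank_le h hrk)
    obtain ⟨y, ⟨x, hx⟩, hy'⟩ := SetLike.not_le_iff_exists.1 this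
    obtain ⟨f, hf, hle⟩ := Submodule.exists_le_ker_of_notMem hy'
    let w : Fin m → F := fun i => f (Pi.single i 1)
    have hfw : ∀ z, f z = w ⬝ᵥ z := by
      intro z
      rw [LinearMap.pi_apply_eq_sum_univ f z]
      simp only [dotProduct, w, smul_eq_mul]
      refine Finset.sum_congr rfl fun i _ => ?_
      rw [mul_comm]
      congr 2
      ext j
      simp [Pi.single_apply, eq_comm]
    have e1 : K'.transpose.mulVec w = 0 := by
      rw [Matrix.mulVec_transpose]
      refine dotProduct_eq_zero _ fun x => ?_
      rw [← Matrix.dotProduct_mulVec, ← hfw]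
      exact hle ⟨x, rfl⟩
    have e2 : K.transpose.mulVec w ≠ 0 := by
      intro h
      rw [Matrix.mulVec_transpose] at h
      apply hf
      rw [hfw, ← hx, Matrix.mulVecLin_apply, Matrix.dotProduct_mulVec, h, zero_dotProduct]
    obtain ⟨P, X, h1, h2⟩ := aux_mat K.transpose K'.transpose A.transpose w e1 e2
      (by simpa using hA) (by simpa using hr)
    refine ⟨X.transpose, P.transpose, ?_, ?_⟩
    · rw [← Matrix.transpose_inj, ← h1]; simp [Matrix.mul_assoc]
    · rw [Matrix.rank_transpose, ← Matrix.rank_transpose] at h2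
      simpa [Matrix.mul_assoc] using h2
  · have : ¬ LinearMap.ker K'.mulVecLin ≤ LinearMap.ker K.mulVecLin := by
      intro h
      refine hker (Submodule.eq_of_le_of_finrank_le h ?_).symm
      have h1 := K.mulVecLin.finrank_range_add_finrank_ker
      have h2 := K'.mulVecLin.finrank_range_add_finrank_ker
      have h3 : K.rank = Module.finrank F (LinearMap.range K.mulVecLin) := rfl
      have h4 : K'.rank = Module.finrank F (LinearMap.range K'.mulVecLin) := rfl
      omega
    obtain ⟨v, hv', hv⟩ := SetLike.not_le_iff_exists.1 this
    exact aux_mat K K' A v (by simpa using hv') (by simpa using hv) hA hr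

/-- `N` of rank at most `rank L` is a two-sided multiple of `L`. -/
theorem aux_factor_s19 {F : Type*} [Field F] {n : ℕ} (L N : Matrix (Fin n) (Fin n) F)
    (hr : N.rank ≤ L.rank) : ∃ P X : Matrix (Fin n) (Fin n) F, P * L * X = N := by
  by_cases hN : N = 0
  · exact ⟨0, 0, by simp [hN]⟩
  have hL : L ≠ 0 := by
    rintro rfl
    have h0 : N.rank = 0 := by simpa using hr
    have h1 : LinearMap.range N.mulVecLin = ⊥ := Submodule.finrank_eq_zero.1 h0
    rw [LinearMap.range_eq_bot] at h1
    refine hN (Matrix.ext_iff_mulVec.2 fun v => ?_)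
    simpa using LinearMap.congr_fun h1 v
  obtain ⟨v, hv⟩ : ∃ v, L.mulVec v ≠ 0 := by
    by_contra! h
    exact hL (Matrix.ext_iff_mulVec.2 (by simpa using h))
  obtain ⟨P, X, h, -⟩ := aux_mat L 0 N v (by simp) hv hN hr
  exact ⟨P, X, h⟩

theorem aux_main {F : Type*} [Field F] {m n : ℕ}
    (c : Con (Matrix (Fin m) (Fin m) F × Matrix (Fin n) (Fin n) F))
    (K K' : Matrix (Fin m) (Fin m) F) (L : Matrix (Fin n) (Fin n) F) (lam : Fˣ)
    (hKK : ¬ HRelM K K') (hrk : K'.rank ≤ K.rank)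
    (hc : c (K, L) (K', (lam : F) • L))
    (M : Matrix (Fin m) (Fin m) F) (N : Matrix (Fin n) (Fin n) F)
    (hM : M.rank ≤ K.rank) (hN : N.rank ≤ L.rank) : c (M, N) (0, N) := by
  have mul3 : ∀ (P X : Matrix (Fin m) (Fin m) F) (Q Y : Matrix (Fin n) (Fin n) F) {a b a' b'},
      c (a, b) (a', b') → c (P * a * X, Q * b * Y) (P * a' * X, Q * b' * Y) := by
    intro P X Q Y a b a' b' h
    exact c.mul (c.mul (c.refl (P, Q)) h) (c.refl (X, Y))
  have hlam : c (0, L) (0, (lam : F) • L) := by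
    simpa using mul3 0 0 1 1 hc
  have key : ∀ r : ℕ, ∀ A : Matrix (Fin m) (Fin m) F, A.rank = r → A.rank ≤ K.rank →
      c (A, L) (0, L) := by
    intro r
    induction r using Nat.strong_induction_on with
    | _ r ih =>
      intro A hAr hA
      by_cases hA0 : A = 0
      · rw [hA0]; exact c.refl _
      obtain ⟨P, X, h1, h2⟩ := aux_mat2 K K' A hKK hrk hA0 hA
      have s1 := mul3 P X 1 1 hc
      rw [h1] at s1
      have s2 := ih _ (hAr ▸ h2) (P * K' * X) rfl (h2.le.trans hA)
      have s3 := mul3 1 1 1 ((lam : F) • 1) s2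
      simp only [one_mul, mul_one, mul_smul_comm] at s1 s3
      exact c.trans s1 (c.trans s3 (c.symm hlam))
  obtain ⟨Q, Y, rfl⟩ := aux_factor_s19 L N hN
  simpa using mul3 1 1 Q Y (key _ M rfl hM)

theorem aux_zero {F : Type*} [Field F] {m n : ℕ}
    (c : Con (Matrix (Fin m) (Fin m) F × Matrix (Fin n) (Fin n) F))
    (K K' : Matrix (Fin m) (Fin m) F) (L : Matrix (Fin n) (Fin n) F) (lam : Fˣ)
    (hc : c (K, L) (K', (lam : F) • L))
    (N : Matrix (Fin n) (Fin n) F) (hN : N.rank ≤ L.rank) (z : ℤ) :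
    c (0, N) (0, ((lam ^ z : Fˣ) : F) • N) := by
  obtain ⟨Q, Y, rfl⟩ := aux_factor_s19 L N hN
  have h1 : ∀ a : F, c (0, a • (Q * L * Y)) (0, (a * (lam : F)) • (Q * L * Y)) := by
    intro a
    have := c.mul (c.mul (c.refl (0, a • Q)) hc) (c.refl (0, Y))
    simpa [smul_smul, mul_comm] using this
  induction z using Int.induction_on with
  | zero => simpa using c.refl _
  | succ i ih =>
    refine c.trans ih ?_
    simpa [zpow_add_one] using h1 ((lam ^ (i : ℤ) : Fˣ) : F)
  | pred i ih =>
    refine c.trans ih (c.symm ?_)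
    have := h1 ((lam ^ (-(i : ℤ) - 1) : Fˣ) : F)
    rw [← Units.val_mul, ← zpow_add_one, sub_add_cancel] at this
    exact this

theorem aux_rank_smul_s19 {F : Type*} [Field F] {n : ℕ} (a : Fˣ) (N : Matrix (Fin n) (Fin n) F) :
    ((a : F) • N).rank = N.rank := by
  apply le_antisymm
  · simpa using Matrix.rank_mul_le_right ((a : F) • (1 : Matrix (Fin n) (Fin n) F)) N
  · simpa [smul_smul] using
      Matrix.rank_mul_le_right ((a⁻¹ : F) • (1 : Matrix (Fin n) (Fin n) F)) ((a : F) • N)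

/-- description of the principal congruence on `F_m × F_n` generated by
`((K, L), (K', λ • L))` when `K, K'` are not H-related and `λ` is a unit of `F`. -/
theorem stmt_19 {F : Type*} [Field F] {m n : ℕ}
    (K K' : Matrix (Fin m) (Fin m) F) (L : Matrix (Fin n) (Fin n) F) (lam : Fˣ)
    (hKK : ¬ HRelM K K') :
    ∀ (M M' : Matrix (Fin m) (Fin m) F) (N N' : Matrix (Fin n) (Fin n) F),
      conGen (fun p q : Matrix (Fin m) (Fin m) F × Matrix (Fin n) (Fin n) F =>
          p = (K, L) ∧ q = (K', (lam : F) • L)) (M, N) (M', N') ↔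
        ((M, N) = (M', N') ∨
          (M.rank ≤ max K.rank K'.rank ∧ M'.rank ≤ max K.rank K'.rank ∧
            N.rank ≤ L.rank ∧
            ∃ z : ℤ, N' = ((lam ^ z : Fˣ) : F) • N)) := by
  intro M M' N N'
  constructor
  · intro h
    let R : Con (Matrix (Fin m) (Fin m) F × Matrix (Fin n) (Fin n) F) :=
      { r := fun p q => p = q ∨ (p.1.rank ≤ max K.rank K'.rank ∧ q.1.rank ≤ max K.rank K'.rank ∧
            p.2.rank ≤ L.rank ∧ ∃ z : ℤ, q.2 = ((lam ^ z : Fˣ) : F) • p.2)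
        iseqv := by
          refine ⟨fun p => Or.inl rfl, ?_, ?_⟩
          · rintro p q (rfl | ⟨h1, h2, h3, z, hz⟩)
            · exact Or.inl rfl
            · refine Or.inr ⟨h2, h1, by rw [hz, aux_rank_smul_s19]; exact h3, -z, ?_⟩
              rw [hz, smul_smul, ← Units.val_mul, ← zpow_add]
              simp
          · rintro p q s (rfl | ⟨h1, h2, h3, z, hz⟩) h'
            · exact h'
            rcases h' with (rfl | ⟨h1', h2', h3', z', hz'⟩)
            · exact Or.inr ⟨h1, h2, h3, z, hz⟩
            · refine Or.inr ⟨h1, h2', h3, z' + z, ?_⟩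
              rw [hz', hz, smul_smul, ← Units.val_mul, ← zpow_add]
        mul' := by
          have hl : ∀ {p q s : Matrix (Fin m) (Fin m) F × Matrix (Fin n) (Fin n) F},
            (p.1.rank ≤ max K.rank K'.rank ∧ q.1.rank ≤ max K.rank K'.rank ∧
              p.2.rank ≤ L.rank ∧ ∃ z : ℤ, q.2 = ((lam ^ z : Fˣ) : F) • p.2) →
            ((s * p).1.rank ≤ max K.rank K'.rank ∧ (s * q).1.rank ≤ max K.rank K'.rank ∧
              (s * p).2.rank ≤ L.rank ∧
                ∃ z : ℤ, (s * q).2 = ((lam ^ z : Fˣ) : F) • (s * p).2) := by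
            rintro p q s ⟨h1, h2, h3, z, hz⟩
            exact ⟨(Matrix.rank_mul_le_right _ _).trans h1, (Matrix.rank_mul_le_right _ _).trans h2,
              (Matrix.rank_mul_le_right _ _).trans h3, z, by simp [hz]⟩
          rintro w x y z (rfl | ⟨h1, h2, h3, t, ht⟩) (rfl | h')
          · exact Or.inl rfl
          · exact Or.inr (hl h')
          · exact Or.inr ⟨(Matrix.rank_mul_le_left _ _).trans h1,
              (Matrix.rank_mul_le_left _ _).trans h2,
              (Matrix.rank_mul_le_left _ _).trans h3, t, by simp [ht]⟩
          · obtain ⟨g1, g2, g3, t', ht'⟩ := h'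
            exact Or.inr ⟨(Matrix.rank_mul_le_left _ _).trans h1,
              (Matrix.rank_mul_le_left _ _).trans h2,
              (Matrix.rank_mul_le_left _ _).trans h3, t' + t, by
                simp [ht, ht', smul_smul, zpow_add, mul_comm]⟩ }
    have hle := (Con.conGen_le (c := R) (r := fun p q => p = (K, L) ∧ q = (K', (lam : F) • L))).2 (by
      rintro p q ⟨rfl, rfl⟩
      exact Or.inr ⟨le_max_left _ _, le_max_right _ _, le_rfl, 1, by simp⟩)
    exact hle h
  · rintro (h | ⟨h1, h2, h3, z, rfl⟩)
    · rw [h]; exact Con.refl _ _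
    generalize hcdef : conGen (fun p q : Matrix (Fin m) (Fin m) F × Matrix (Fin n) (Fin n) F =>
          p = (K, L) ∧ q = (K', (lam : F) • L)) = c
    have hc : c (K, L) (K', (lam : F) • L) := by
      rw [← hcdef]
      exact ConGen.Rel.of _ _ ⟨rfl, rfl⟩
    have hz : ((((lam ^ z : Fˣ) : F) • N)).rank ≤ L.rank := by rw [aux_rank_smul_s19]; exact h3
    have main : ∀ (A : Matrix (Fin m) (Fin m) F) (B : Matrix (Fin n) (Fin n) F),
        A.rank ≤ max K.rank K'.rank → B.rank ≤ L.rank → c (A, B) (0, B) := by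
      intro A B hA hB
      rcases le_total K'.rank K.rank with hk | hk
      · rw [max_eq_left hk] at hA
        exact aux_main c K K' L lam hKK hk hc A B hA hB
      · rw [max_eq_right hk] at hA
        refine aux_main c K' K ((lam : F) • L) lam⁻¹ (fun h => hKK ⟨h.1.symm, h.2.symm⟩) hk
          ?_ A B hA (by rw [aux_rank_smul_s19]; exact hB)
        simpa [smul_smul] using c.symm hc
    exact c.trans (main M N h1 h3)
      (c.trans (aux_zero c K K' L lam hc N h3 z) (c.symm (main M' _ h2 hz)))
end
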